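/- arXiv:2011.04457 — 2 statements merged into one kernel-verified Lean document; each statement's English description precedes it below -/
import Mathlib

section
/- Let X ∈ {0,1}^{n×m} with E ≠ ∅ and let k ≥ 2. For each pair of indices ℓ₁ < ℓ₂ in [k], the assignment a_{iℓ} = b_{ℓj} = 1/2 for all i, ℓ, j, y_{iℓj} = 1/2 for (i,j) ∈ E and ℓ ∈ {ℓ₁, ℓ₂}, y_{iℓj} = 0 otherwise, z_{ij} = 1 for (i,j) ∈ E and z_{ij} = 0 for (i,j) ∉ E, is a feasible solution of LP_exact with objective value 0; distinct pairs {ℓ₁, ℓ₂} yield distinct solutions, so LP_exact has at least k(k−1)/2 optimal solutions. -/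
/-- The McCormick envelope `MC(a,b) = {y : a + b − 1 ≤ y, y ≤ a, y ≤ b, 0 ≤ y}`. -/
def MC (a b y : ℝ) : Prop := a + b - 1 ≤ y ∧ y ≤ a ∧ y ≤ b ∧ 0 ≤ y

/-- Feasibility for the LP relaxation `LP_exact` of the compact formulation. -/
def LPexactFeasible (n m k : ℕ)
    (a : Fin n → Fin k → ℝ) (b : Fin k → Fin m → ℝ)
    (y : Fin n → Fin k → Fin m → ℝ) (z : Fin n → Fin m → ℝ) : Prop :=
  (∀ i ℓ, a i ℓ ∈ Set.Icc (0 : ℝ) 1) ∧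
  (∀ ℓ j, b ℓ j ∈ Set.Icc (0 : ℝ) 1) ∧
  (∀ i ℓ j, y i ℓ j ≤ z i j) ∧
  (∀ i j, z i j ≤ ∑ ℓ, y i ℓ j) ∧
  (∀ i ℓ j, MC (a i ℓ) (b ℓ j) (y i ℓ j)) ∧
  (∀ i j, z i j ≤ 1)

/-- The objective of `LP_exact`: `Σ_{(i,j)∈E}(1 − z_{ij}) + Σ_{(i,j)∉E} z_{ij}`. -/
def LPexactObj (n m : ℕ) (X : Fin n → Fin m → ℕ) (z : Fin n → Fin m → ℝ) : ℝ :=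
  (∑ p ∈ Finset.univ.filter (fun p : Fin n × Fin m => X p.1 p.2 = 1), (1 - z p.1 p.2)) +
  ∑ p ∈ Finset.univ.filter (fun p : Fin n × Fin m => X p.1 p.2 ≠ 1), z p.1 p.2

/-- The particular `y`-assignment associated to a pair of indices `ℓ₁, ℓ₂ ∈ [k]`:
`y_{iℓj} = 1/2` for `(i,j) ∈ E` and `ℓ ∈ {ℓ₁, ℓ₂}`, and `y_{iℓj} = 0` otherwise. -/
noncomputable def Ypair (n m k : ℕ) (X : Fin n → Fin m → ℕ) (ℓ₁ ℓ₂ : Fin k) :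
    Fin n → Fin k → Fin m → ℝ :=
  fun i ℓ j => if X i j = 1 ∧ (ℓ = ℓ₁ ∨ ℓ = ℓ₂) then 1 / 2 else 0

/-- The half-integral assignment attached to two distinct indices is feasible. -/
lemma LPexactFeasible_Ypair (n m k : ℕ) (X : Fin n → Fin m → ℕ) {ℓ₁ ℓ₂ : Fin k} (h : ℓ₁ ≠ ℓ₂) :
    LPexactFeasible n m k (fun _ _ => 1 / 2) (fun _ _ => 1 / 2)
      (Ypair n m k X ℓ₁ ℓ₂) (fun i j => if X i j = 1 then 1 else 0) := by
  refine ⟨fun _ _ => by norm_num, fun _ _ => by norm_num, fun i ℓ j => ?_, fun i j => ?_,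
    fun i ℓ j => ?_, fun i j => ?_⟩
  · unfold Ypair
    split_ifs <;> grind
  · by_cases hx : X i j = 1
    · calc (if X i j = 1 then (1 : ℝ) else 0) = ∑ ℓ ∈ {ℓ₁, ℓ₂}, Ypair n m k X ℓ₁ ℓ₂ i ℓ j := by
            rw [Finset.sum_pair h]; norm_num [Ypair, hx]
        _ ≤ ∑ ℓ, Ypair n m k X ℓ₁ ℓ₂ i ℓ j := by
            refine Finset.sum_le_sum_of_subset_of_nonneg (Finset.subset_univ _) fun ℓ _ _ => ?_
            unfold Ypair
            split_ifs <;> norm_num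
    · simp [Ypair, hx]
  · unfold Ypair MC
    split_ifs <;> norm_num
  · dsimp only
    split_ifs <;> norm_num

/-- The indicator of `E` has objective value `0`. -/
lemma LPexactObj_indicator (n m : ℕ) (X : Fin n → Fin m → ℕ) :
    LPexactObj n m X (fun i j => if X i j = 1 then 1 else 0) = 0 := by
  unfold LPexactObj
  rw [Finset.sum_eq_zero, Finset.sum_eq_zero, add_zero] <;> simp +contextual

/-- If `E ≠ ∅`, an ordered pair of indices is determined by its `y`-assignment. -/
lemma Ypair_injective (n m k : ℕ) (X : Fin n → Fin m → ℕ) (hE : ∃ i j, X i j = 1)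
    {ℓ₁ ℓ₂ ℓ₁' ℓ₂' : Fin k} (h : ℓ₁ < ℓ₂) (h' : ℓ₁' < ℓ₂')
    (heq : Ypair n m k X ℓ₁ ℓ₂ = Ypair n m k X ℓ₁' ℓ₂') : (ℓ₁, ℓ₂) = (ℓ₁', ℓ₂') := by
  obtain ⟨i, j, hx⟩ := hE
  have key : ∀ ℓ, (ℓ = ℓ₁ ∨ ℓ = ℓ₂) ↔ (ℓ = ℓ₁' ∨ ℓ = ℓ₂') := fun ℓ => by
    have := congrFun (congrFun (congrFun heq i) ℓ) j
    simp only [Ypair, hx, true_and] at this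
    split_ifs at this <;> simp_all
  have h1 := key ℓ₁
  have h2 := key ℓ₂
  have h3 := key ℓ₁'
  have h4 := key ℓ₂'
  grind

/-- There are `k(k-1)/2` strictly increasing pairs in `Fin k`. -/
lemma card_sigma_Iio (k : ℕ) :
    ((Finset.univ : Finset (Fin k)).sigma fun j => Finset.Iio j).card = k * (k - 1) / 2 := by
  simp only [Finset.card_sigma, Fin.card_Iio]
  rw [Fin.sum_univ_eq_sum_range (fun i => i) k, Finset.sum_range_id]

/-- Let `X ∈ {0,1}^{n×m}` with `E ≠ ∅` and `k ≥ 2`. For each pair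
`ℓ₁ < ℓ₂` in `[k]`, the assignment `a = b = 1/2`, `y_{iℓj} = 1/2` for `(i,j) ∈ E` and
`ℓ ∈ {ℓ₁,ℓ₂}`, `y = 0` otherwise, `z = 1` on `E` and `0` off `E`, is feasible for
`LP_exact` with objective value `0`; distinct pairs yield distinct solutions, so
`LP_exact` has at least `k(k−1)/2` optimal solutions (feasible solutions of objective
value `0`). -/
theorem stmt_6 (n m k : ℕ) (hk : 2 ≤ k) (X : Fin n → Fin m → ℕ)
    (hX : ∀ i j, X i j = 0 ∨ X i j = 1)
    (hE : ∃ i j, X i j = 1) :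
    (∀ ℓ₁ ℓ₂ : Fin k, ℓ₁ < ℓ₂ →
      LPexactFeasible n m k (fun _ _ => 1 / 2) (fun _ _ => 1 / 2)
        (Ypair n m k X ℓ₁ ℓ₂) (fun i j => if X i j = 1 then 1 else 0) ∧
      LPexactObj n m X (fun i j => if X i j = 1 then 1 else 0) = 0) ∧
    (∀ ℓ₁ ℓ₂ ℓ₁' ℓ₂' : Fin k, ℓ₁ < ℓ₂ → ℓ₁' < ℓ₂' → (ℓ₁, ℓ₂) ≠ (ℓ₁', ℓ₂') →
      Ypair n m k X ℓ₁ ℓ₂ ≠ Ypair n m k X ℓ₁' ℓ₂') ∧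
    ∃ S : Finset ((Fin n → Fin k → ℝ) × (Fin k → Fin m → ℝ) ×
        (Fin n → Fin k → Fin m → ℝ) × (Fin n → Fin m → ℝ)),
      k * (k - 1) / 2 ≤ S.card ∧
      ∀ s ∈ S, LPexactFeasible n m k s.1 s.2.1 s.2.2.1 s.2.2.2 ∧
        LPexactObj n m X s.2.2.2 = 0 := by
  refine ⟨fun ℓ₁ ℓ₂ h => ⟨LPexactFeasible_Ypair n m k X h.ne, LPexactObj_indicator n m X⟩,
    fun ℓ₁ ℓ₂ ℓ₁' ℓ₂' h h' hne heq => hne (Ypair_injective n m k X hE h h' heq), ?_⟩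
  classical
  refine ⟨((Finset.univ : Finset (Fin k)).sigma fun j => Finset.Iio j).image fun p =>
    (fun _ _ => 1 / 2, fun _ _ => 1 / 2, Ypair n m k X p.2 p.1,
      fun i j => if X i j = 1 then 1 else 0), ?_, ?_⟩
  · rw [Finset.card_image_of_injOn, card_sigma_Iio]
    rintro ⟨a, b⟩ hab ⟨c, d⟩ hcd heq
    have hba : b < a := by simpa using hab
    have hdc : d < c := by simpa using hcd
    have hY : Ypair n m k X b a = Ypair n m k X d c := congrArg (fun s => s.2.2.1) heq
    have := Ypair_injective n m k X hE hba hdc hY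
    simp_all
  · intro s hs
    obtain ⟨⟨a, b⟩, hab, rfl⟩ := Finset.mem_image.1 hs
    have hba : b < a := by simpa using hab
    exact ⟨LPexactFeasible_Ypair n m k X hba.ne, LPexactObj_indicator n m X⟩
end

section
/- Let X = J₄ − I₄ ∈ {0,1}^{4×4} and k = 3. Then MLP_exact has optimal objective value 0: the solution assigning q_Y = 1/2 to the six rank-1 binary matrices Y = a bᵀ with a the indicator vector of a 2-element subset P ⊆ {1,2,3,4} and b the indicator vector of the complement {1,2,3,4} \ P, q_Y = 0 for all other Y ∈ R, ξ = 0 and π = 0, is feasible for MLP_exact with objective value 0. -/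
/-- The index set `E = {(i,j) : x_{ij} = 1}` of positive entries of `X`. -/
def Eset (n m : ℕ) (X : Fin n → Fin m → ℕ) : Finset (Fin n × Fin m) :=
  Finset.univ.filter fun p => X p.1 p.2 = 1

/-- The complement of `E`: indices `(i,j)` with `x_{ij} ≠ 1`. -/
def Ecomp (n m : ℕ) (X : Fin n → Fin m → ℕ) : Finset (Fin n × Fin m) :=
  Finset.univ.filter fun p => X p.1 p.2 ≠ 1

/-- The set `R = {a bᵀ : a ∈ {0,1}^n \ {0}, b ∈ {0,1}^m \ {0}}` of all nonzero
rank-1 binary `n×m` matrices, as a `Finset` (each pair of nonzero binary vectors is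
encoded by a pair of nonzero Boolean vectors). -/
def Rset (n m : ℕ) : Finset (Fin n → Fin m → ℕ) :=
  ((Finset.univ : Finset ((Fin n → Bool) × (Fin m → Bool))).filter
      fun p => p.1 ≠ (fun _ => false) ∧ p.2 ≠ (fun _ => false)).image
    fun p => fun i j => (if p.1 i then 1 else 0) * (if p.2 j then 1 else 0)
/-- Feasibility for the master LP relaxation `MLP_exact`: variables `ξ_{ij} ≥ 0` for
`(i,j) ∈ E`, `π_{ij} ∈ [0,1]` for `(i,j) ∉ E`, `q_Y ∈ [0,1]` for `Y ∈ R`, subject to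
`Σ_Y Y_{ij} q_Y + ξ_{ij} ≥ 1` for `(i,j) ∈ E`, `Σ_Y Y_{ij} q_Y ≤ k π_{ij}` for
`(i,j) ∉ E`, and `Σ_Y q_Y ≤ k`. -/
def MLPexactFeasible (n m k : ℕ) (X : Fin n → Fin m → ℕ)
    (ξ π : Fin n → Fin m → ℝ) (q : (Fin n → Fin m → ℕ) → ℝ) : Prop :=
  (∀ i j, X i j = 1 → 0 ≤ ξ i j) ∧
  (∀ i j, X i j ≠ 1 → π i j ∈ Set.Icc (0 : ℝ) 1) ∧
  (∀ Y ∈ Rset n m, q Y ∈ Set.Icc (0 : ℝ) 1) ∧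
  (∀ i j, X i j = 1 → 1 ≤ (∑ Y ∈ Rset n m, (Y i j : ℝ) * q Y) + ξ i j) ∧
  (∀ i j, X i j ≠ 1 → (∑ Y ∈ Rset n m, (Y i j : ℝ) * q Y) ≤ k * π i j) ∧
  (∑ Y ∈ Rset n m, q Y) ≤ k

/-- The objective of `MLP_exact`: `Σ_{(i,j)∈E} ξ_{ij} + Σ_{(i,j)∉E} π_{ij}`. -/
def MLPexactObj (n m : ℕ) (X : Fin n → Fin m → ℕ) (ξ π : Fin n → Fin m → ℝ) : ℝ :=
  (∑ p ∈ Eset n m X, ξ p.1 p.2) + ∑ p ∈ Ecomp n m X, π p.1 p.2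

/-- The matrix `X = J₄ − I₄ ∈ {0,1}^{4×4}`: zeros on the diagonal, ones off the
diagonal. -/
def XJI : Fin 4 → Fin 4 → ℕ := fun i j => if i = j then 0 else 1

/-- The fractional solution assigning weight `1/2` to each of the six rank-1 binary
matrices `a bᵀ` where `a` is the indicator vector of a 2-element subset
`P ⊆ {1,2,3,4}` and `b` is the indicator vector of its complement, and `0` to every
other matrix. -/
noncomputable def qSpec : (Fin 4 → Fin 4 → ℕ) → ℝ := fun Y =>
  if ∃ P : Finset (Fin 4), P.card = 2 ∧
      Y = (fun i j => (if i ∈ P then 1 else 0) * (if j ∈ P then 0 else 1))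
  then 1 / 2 else 0

/-- The rank-1 matrix `a bᵀ` with `a` the indicator of `P` and `b` that of its complement. -/
def cutMatrix {n : ℕ} (P : Finset (Fin n)) : Fin n → Fin n → ℕ :=
  fun i j => (if i ∈ P then 1 else 0) * (if j ∈ P then 0 else 1)

theorem cutMatrix_mem_Rset {n : ℕ} {P : Finset (Fin n)} (hP : P.Nonempty)
    (hPc : Pᶜ.Nonempty) : cutMatrix P ∈ Rset n n := by
  obtain ⟨i, hi⟩ := hP
  obtain ⟨j, hj⟩ := hPc
  refine Finset.mem_image.2 ⟨(fun i => decide (i ∈ P), fun j => decide (j ∉ P)), ?_, ?_⟩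
  · refine Finset.mem_filter.2 ⟨Finset.mem_univ _, fun h => ?_, fun h => ?_⟩
    · simpa [hi] using congrFun h i
    · simpa [Finset.mem_compl.1 hj] using congrFun h j
  · funext i j
    simp [cutMatrix]

theorem cutMatrix_injOn :
    Set.InjOn cutMatrix (↑(Finset.powersetCard 2 (Finset.univ : Finset (Fin 4))) :
      Set (Finset (Fin 4))) := by
  have h : ∀ P ∈ Finset.powersetCard 2 (Finset.univ : Finset (Fin 4)),
      ∀ Q ∈ Finset.powersetCard 2 (Finset.univ : Finset (Fin 4)),
      cutMatrix P = cutMatrix Q → P = Q := by decide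
  exact fun P hP Q hQ => h P hP Q hQ

theorem sum_mul_qSpec (f : (Fin 4 → Fin 4 → ℕ) → ℝ) :
    ∑ Y ∈ Rset 4 4, f Y * qSpec Y =
      ∑ P ∈ Finset.powersetCard 2 (Finset.univ : Finset (Fin 4)), f (cutMatrix P) * (1 / 2) := by
  have hsub : (Finset.powersetCard 2 (Finset.univ : Finset (Fin 4))).image cutMatrix ⊆
      Rset 4 4 := by
    refine Finset.image_subset_iff.2 fun P hP => ?_
    have hcard := (Finset.mem_powersetCard.1 hP).2
    refine cutMatrix_mem_Rset (Finset.card_pos.1 (by omega)) (Finset.card_pos.1 ?_)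
    rw [Finset.card_compl, hcard, Fintype.card_fin]
    norm_num
  rw [← Finset.sum_subset hsub, Finset.sum_image cutMatrix_injOn]
  · refine Finset.sum_congr rfl fun P hP => ?_
    rw [qSpec, if_pos ⟨P, (Finset.mem_powersetCard.1 hP).2, rfl⟩]
  · intro Y _ hY
    rw [qSpec, if_neg, mul_zero]
    rintro ⟨P, hP, rfl⟩
    exact hY (Finset.mem_image_of_mem _
      (Finset.mem_powersetCard.2 ⟨Finset.subset_univ P, hP⟩))

theorem sum_entry_mul_qSpec (i j : Fin 4) :
    ∑ Y ∈ Rset 4 4, (Y i j : ℝ) * qSpec Y = XJI i j := by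
  have h : ∀ i j : Fin 4, ∑ P ∈ Finset.powersetCard 2 (Finset.univ : Finset (Fin 4)),
      cutMatrix P i j = 2 * XJI i j := by decide
  rw [sum_mul_qSpec fun Y => (Y i j : ℝ), ← Finset.sum_mul, ← Nat.cast_sum, h]
  push_cast
  ring

theorem sum_qSpec : ∑ Y ∈ Rset 4 4, qSpec Y = 3 := by
  have h := sum_mul_qSpec fun _ => 1
  simp only [one_mul, Finset.sum_const, Finset.card_powersetCard, Finset.card_univ,
    Fintype.card_fin] at h
  rw [h, show Nat.choose 4 2 = 6 from rfl]
  norm_num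

theorem qSpec_mem_Icc (Y : Fin 4 → Fin 4 → ℕ) : qSpec Y ∈ Set.Icc (0 : ℝ) 1 := by
  unfold qSpec
  split_ifs <;> norm_num

theorem MLPexactObj_nonneg {n m k : ℕ} {X : Fin n → Fin m → ℕ} {ξ π : Fin n → Fin m → ℝ}
    {q : (Fin n → Fin m → ℕ) → ℝ} (h : MLPexactFeasible n m k X ξ π q) :
    0 ≤ MLPexactObj n m X ξ π :=
  add_nonneg
    (Finset.sum_nonneg fun p hp => h.1 p.1 p.2 (Finset.mem_filter.1 hp).2)
    (Finset.sum_nonneg fun p hp => (h.2.1 p.1 p.2 (Finset.mem_filter.1 hp).2).1)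

theorem qSpec_feasible :
    MLPexactFeasible 4 4 3 XJI (fun _ _ => 0) (fun _ _ => 0) qSpec := by
  refine ⟨fun _ _ _ => le_rfl, fun _ _ _ => ⟨le_rfl, zero_le_one⟩,
    fun Y _ => qSpec_mem_Icc Y, fun i j h => ?_, fun i j h => ?_, ?_⟩
  · simp [sum_entry_mul_qSpec, h]
  · have h0 : XJI i j = 0 := by
      unfold XJI at h ⊢
      split_ifs at h ⊢ <;> simp_all
    simp [sum_entry_mul_qSpec, h0]
  · simp [sum_qSpec]

/-- For `X = J₄ − I₄` and `k = 3`, `MLP_exact` has optimal objective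
value `0`: the solution `qSpec` (weight `1/2` on the six rank-1 matrices indexed by
2-element subsets `P` with their complements), together with `ξ = 0` and `π = 0`, is
feasible for `MLP_exact` with objective value `0`. -/
theorem stmt_18 :
    MLPexactFeasible 4 4 3 XJI (fun _ _ => 0) (fun _ _ => 0) qSpec ∧
    MLPexactObj 4 4 XJI (fun _ _ => 0) (fun _ _ => 0) = 0 ∧
    sInf {v : ℝ | ∃ (ξ π : Fin 4 → Fin 4 → ℝ) (q : (Fin 4 → Fin 4 → ℕ) → ℝ),
        MLPexactFeasible 4 4 3 XJI ξ π q ∧ v = MLPexactObj 4 4 XJI ξ π} = 0 := by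
  have hobj : MLPexactObj 4 4 XJI (fun _ _ => 0) (fun _ _ => 0) = 0 := by
    simp [MLPexactObj]
  refine ⟨qSpec_feasible, hobj, IsLeast.csInf_eq ⟨⟨_, _, _, qSpec_feasible, hobj.symm⟩, ?_⟩⟩
  rintro _ ⟨ξ, π, q, h, rfl⟩
  exact MLPexactObj_nonneg h
end
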